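/- (Positive half of the counterexample proving Theorem 5.) Let h₂ be the complete history ⟨inv(2,pop,⊥), inv(1,push,1), ret(1,push,⊥), inv(1,push,2), ret(1,push,⊥), inv(1,pop,⊥), ret(1,pop,1), inv(1,pop,⊥), ret(1,pop,2), inv(1,push,3), ret(1,push,⊥), ret(2,pop,3)⟩, in which thread 2's pop overlaps all of thread 1's operation calls. Then h₂ satisfies quiescent consistency with respect to the stack: there exists a mapping function f with VMF(h₂,f), qc(h₂,f), total(h₂,f), and map(h₂,f) a legal sequential stack history from the empty stack [] (a witness maps the events in the abstract order push(1), pop→1, push(2), pop→2, push(3), pop→3; qc holds vacuously since no index m < 11 is a quiescent point of h₂, thread 2's invocation at index 0 being pending in every proper prefix). -/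

import Mathlib

/-- Operation names of the stack object. -/
inductive Op where
  | push | pop
  deriving DecidableEq

/-- Values together with the distinguished symbols `⊥` (no input/output) and `empty`. -/
inductive EVal where
  | val : ℕ → EVal
  | bot | empty
  deriving DecidableEq

/-- Invocation and return events (thread identifier, operation name, input/output value). -/
inductive Event where
  | inv : ℕ → Op → EVal → Event
  | ret : ℕ → Op → EVal → Event
  deriving DecidableEq

/-- The thread of an event. -/
def Event.thread : Event → ℕ
  | .inv t _ _ => t
  | .ret t _ _ => t

/-- `mp m n h`: indices `m < n` form a matching pair in history `h`. -/
def mp (m n : ℕ) (h : List Event) : Prop :=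
  m < n ∧ n < h.length ∧
    ∃ t o u v, h[m]? = some (Event.inv t o u) ∧ h[n]? = some (Event.ret t o v) ∧
      ∀ i e, m < i → i < n → h[i]? = some e → e.thread ≠ t

/-- `pi m h`: index `m` is a pending invocation in history `h`. -/
def pi (m : ℕ) (h : List Event) : Prop :=
  m < h.length ∧ ∀ n, m < n → n < h.length →
    ¬ ∃ t o u v, h[m]? = some (Event.inv t o u) ∧ h[n]? = some (Event.ret t o v)

/-- `VMF h f`: `f` (a partial function on indices, modelled via `Option`) is a valid
mapping function for history `h`. -/
def VMF (h : List Event) (f : ℕ → Option ℕ) : Prop :=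
  (∀ m k, f m = some k → m < h.length) ∧
  (∃ n, ∀ k, (∃ m, f m = some k) ↔ k < n) ∧
  (∀ m m' k, f m = some k → f m' = some k → m = m') ∧
  (∀ m n, mp m n h → ((∃ k, f m = some k) ↔ ∃ k, f n = some k)) ∧
  (∀ m n k, mp m n h → f m = some k → f n = some (k + 1))

/-- `mapped h f g`: `g` is the mapped history `map(h,f)`, i.e. the sequence of length
`|ran f|` whose element at position `f.k` is `h.k`. -/
def mapped (h : List Event) (f : ℕ → Option ℕ) (g : List Event) : Prop :=
  (∀ k, k < g.length ↔ ∃ m, f m = some k) ∧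
  (∀ m k, f m = some k → g[k]? = h[m]?)

/-- `total h f`: every non-pending index of `h` is in the domain of `f`. -/
def total (h : List Event) (f : ℕ → Option ℕ) : Prop :=
  ∀ m, m < h.length → ¬ pi m h → ∃ k, f m = some k

/-- The event at index `m` of `h` is a return event. -/
def isRetAt (h : List Event) (m : ℕ) : Prop :=
  ∃ t o v, h[m]? = some (Event.ret t o v)

/-- The event at index `m` of `h` is an invocation event. -/
def isInvAt (h : List Event) (m : ℕ) : Prop :=
  ∃ t o v, h[m]? = some (Event.inv t o v)

/-- Linearizability ordering condition. -/
def lin (h : List Event) (f : ℕ → Option ℕ) : Prop :=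
  ∀ m n km kn, f m = some km → f n = some kn → m < n →
    isRetAt h m → isInvAt h n → km < kn

/-- Sequential consistency ordering condition (per-thread order preserved). -/
def sc (h : List Event) (f : ℕ → Option ℕ) : Prop :=
  ∀ m n km kn, f m = some km → f n = some kn → m < n →
    (∃ t o v o' v', h[m]? = some (Event.ret t o v) ∧ h[n]? = some (Event.inv t o' v')) →
    km < kn

/-- `qp m h`: index `m` is a quiescent point of `h`. -/
def qp (m : ℕ) (h : List Event) : Prop :=
  ∀ n, n ≤ m → ¬ pi n (h.take (m + 1))

/-- Quiescent consistency ordering condition (order across quiescent points preserved). -/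
def qc (h : List Event) (f : ℕ → Option ℕ) : Prop :=
  ∀ m k n km kk kn, f m = some km → f k = some kk → f n = some kn →
    m < k → k < n → qp k h → km < kn

/-- Legal sequential stack histories starting from stack contents `S`. -/
inductive LegalStack : List ℕ → List Event → Prop where
  | nil (S : List ℕ) : LegalStack S []
  | push (S : List ℕ) (t v : ℕ) (r : List Event) :
      LegalStack (v :: S) r →
      LegalStack S (Event.inv t Op.push (EVal.val v) :: Event.ret t Op.push EVal.bot :: r)
  | popEmpty (t : ℕ) (r : List Event) :
      LegalStack [] r →
      LegalStack [] (Event.inv t Op.pop EVal.bot :: Event.ret t Op.pop EVal.empty :: r)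
  | pop (S : List ℕ) (t v : ℕ) (r : List Event) :
      LegalStack S r →
      LegalStack (v :: S) (Event.inv t Op.pop EVal.bot :: Event.ret t Op.pop (EVal.val v) :: r)

/-- The history `h₂` of the counterexample for quiescent consistency (Theorem 5). -/
def h₂ : List Event :=
  [Event.inv 2 Op.pop EVal.bot,
   Event.inv 1 Op.push (EVal.val 1), Event.ret 1 Op.push EVal.bot,
   Event.inv 1 Op.push (EVal.val 2), Event.ret 1 Op.push EVal.bot,
   Event.inv 1 Op.pop EVal.bot, Event.ret 1 Op.pop (EVal.val 1),
   Event.inv 1 Op.pop EVal.bot, Event.ret 1 Op.pop (EVal.val 2),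
   Event.inv 1 Op.push (EVal.val 3), Event.ret 1 Op.push EVal.bot,
   Event.ret 2 Op.pop (EVal.val 3)]

/-- The position of each event of `h₂` in the order
`push(1), pop→1, push(2), pop→2, push(3), pop→3`. -/
def h₂Order : List ℕ := [10, 0, 1, 4, 5, 2, 3, 6, 7, 8, 9, 11]

/-- The sequential history obtained by reordering `h₂` along `h₂Order`. -/
def h₂Sequential : List Event :=
  [Event.inv 1 Op.push (EVal.val 1), Event.ret 1 Op.push EVal.bot,
   Event.inv 1 Op.pop EVal.bot, Event.ret 1 Op.pop (EVal.val 1),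
   Event.inv 1 Op.push (EVal.val 2), Event.ret 1 Op.push EVal.bot,
   Event.inv 1 Op.pop EVal.bot, Event.ret 1 Op.pop (EVal.val 2),
   Event.inv 1 Op.push (EVal.val 3), Event.ret 1 Op.push EVal.bot,
   Event.inv 2 Op.pop EVal.bot, Event.ret 2 Op.pop (EVal.val 3)]

theorem h₂Order_lt_length {m k : ℕ} (h : h₂Order[m]? = some k) : m < 12 :=
  (List.getElem?_eq_some_iff.1 h).1

theorem h₂Order_range (k : ℕ) : (∃ m : ℕ, h₂Order[m]? = some k) ↔ k < 12 := by
  have hperm : h₂Order.Perm (List.range 12) := by decide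
  exact List.mem_iff_getElem?.symm.trans (hperm.mem_iff.trans List.mem_range)

theorem h₂Order_injective {m n k : ℕ} (hm : h₂Order[m]? = some k)
    (hn : h₂Order[n]? = some k) : m = n := by
  have hnodup : h₂Order.Nodup := by decide
  exact (List.getElem?_inj (h₂Order_lt_length hm) hnodup).1 (hm.trans hn.symm)

theorem h₂Sequential_getElem? {m k : ℕ} (h : h₂Order[m]? = some k) :
    h₂Sequential[k]? = h₂[m]? := by
  have hm := h₂Order_lt_length h
  interval_cases m <;> (cases h; rfl)

/-- Each matching pair of `h₂` is sent to consecutive positions by `h₂Order`. -/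
theorem h₂Order_of_mp {m n : ℕ} (h : mp m n h₂) :
    ∃ k, h₂Order[m]? = some k ∧ h₂Order[n]? = some (k + 1) := by
  obtain ⟨hmn, hn, t, o, u, v, hi, hr, hbetween⟩ := h
  have hnext : m + 1 < n → ∀ e, h₂[m + 1]? = some e → e.thread ≠ t :=
    fun hlt e => hbetween (m + 1) e m.lt_succ_self hlt
  clear hbetween
  change n < 12 at hn
  have hm : m < 12 := hmn.trans hn
  interval_cases m <;> cases hi <;> interval_cases n <;> cases hr <;>
    first
    | exact ⟨_, rfl, rfl⟩
    | exact absurd rfl (hnext (by decide) _ rfl)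

theorem not_qp_h₂ {k : ℕ} (hk : k < 11) : ¬ qp k h₂ := by
  intro h
  refine h 0 k.zero_le ⟨by simp [h₂], ?_⟩
  rintro n - hn ⟨t, o, u, v, hi, hr⟩
  have hn' : n < k + 1 := hn.trans_le (by simp)
  rw [List.getElem?_take_of_lt k.succ_pos] at hi
  rw [List.getElem?_take_of_lt hn'] at hr
  have hn₁ : n < 11 := by omega
  cases hi
  clear hn hn' h
  interval_cases n <;> cases hr

theorem legalStack_h₂Sequential : LegalStack [] h₂Sequential :=
  .push _ _ _ _ <| .pop _ _ _ _ <| .push _ _ _ _ <| .pop _ _ _ _ <|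
    .push _ _ _ _ <| .pop _ _ _ _ <| .nil _

/-- `h₂` is quiescent consistent with respect to the stack. -/
theorem h₂_quiescent_consistent :
    ∃ (f : ℕ → Option ℕ) (g : List Event),
      VMF h₂ f ∧ qc h₂ f ∧ total h₂ f ∧ mapped h₂ f g ∧ LegalStack [] g := by
  refine ⟨fun m => h₂Order[m]?, h₂Sequential,
    ⟨fun _ _ => h₂Order_lt_length, ⟨12, h₂Order_range⟩, fun _ _ _ => h₂Order_injective,
      fun m n h => ?_, fun m n k h hm => ?_⟩,
    fun m k n _ _ _ _ _ hn _ hkn hq => ?_, fun m hm _ => ?_,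
    ⟨fun k => (h₂Order_range k).symm, fun _ _ => h₂Sequential_getElem?⟩,
    legalStack_h₂Sequential⟩
  · obtain ⟨k, hm, hn⟩ := h₂Order_of_mp h
    exact ⟨fun _ => ⟨_, hn⟩, fun _ => ⟨_, hm⟩⟩
  · obtain ⟨k', hm', hn⟩ := h₂Order_of_mp h
    rwa [Option.some.inj (hm.symm.trans hm')]
  · have := h₂Order_lt_length hn
    exact absurd hq (not_qp_h₂ (by omega))
  · exact ⟨_, List.getElem?_eq_getElem (l := h₂Order) hm⟩
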